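/- Let L ⊆ a* be a Păun generated language over the one-letter alphabet {a} (circular words over {a} being identified with words). Then there exists a Păun circular splicing system ({a}, I, R) generating L in which either R = ∅ or R = {r} consists of a single rule. -/

import Mathlib

/-- Conjugacy of words: `w` and `w'` are conjugate iff `w = x ++ y` and `w' = y ++ x`. -/
def WordConj {A : Type*} (w w' : List A) : Prop :=
  ∃ x y : List A, w = x ++ y ∧ w' = y ++ x

/-- A Păun circular splicing rule `u1#u2$u3#u4`. -/
structure CircRule (A : Type*) where
  u1 : List A
  u2 : List A
  u3 : List A
  u4 : List A

/-- One circular splicing step (at the level of full linearizations): a rule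
`u1#u2$u3#u4` applied to circular words with linearizations `u2 x u1` and `u4 y u3`
produces every linearization of the circular word `~(u2 x u1 u4 y u3)`. -/
def CircStep {A : Type*} (R : Set (CircRule A)) (L : Set (List A)) (w : List A) : Prop :=
  ∃ r ∈ R, ∃ x y : List A,
    r.u2 ++ x ++ r.u1 ∈ L ∧ r.u4 ++ y ++ r.u3 ∈ L ∧
    WordConj w (r.u2 ++ x ++ r.u1 ++ r.u4 ++ y ++ r.u3)

/-- The full linearization of the circular language generated by the Păun circular
splicing system `(A, ~I, R)`: the smallest conjugacy-closed set of words containing all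
conjugates of words of `I` and closed under the splicing steps. -/
def CircLang {A : Type*} (I : Set (List A)) (R : Set (CircRule A)) : Set (List A) :=
  ⋂₀ {L : Set (List A) |
      (∀ w ∈ I, ∀ w', WordConj w w' → w' ∈ L) ∧ ∀ w, CircStep R L w → w ∈ L}

theorem aux_eq {w w' : List Unit} (h : w.length = w'.length) : w = w' :=
  List.ext_getElem h (fun _ _ _ => rfl)

theorem aux_conj {w w' : List Unit} : WordConj w w' ↔ w = w' := by
  constructor
  · rintro ⟨x, y, rfl, rfl⟩
    exact aux_eq (by simp [Nat.add_comm])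
  · rintro rfl
    exact ⟨w, [], by simp, by simp⟩

theorem aux_step (R : Set (CircRule Unit)) (L : Set (List Unit)) (w : List Unit) :
    CircStep R L w ↔ ∃ r ∈ R, ∃ u v : List Unit, u ∈ L ∧ v ∈ L ∧
      r.u1.length + r.u2.length ≤ u.length ∧ r.u3.length + r.u4.length ≤ v.length ∧
      w.length = u.length + v.length := by
  constructor
  · rintro ⟨r, hr, x, y, h1, h2, h3⟩
    rw [aux_conj] at h3
    refine ⟨r, hr, _, _, h1, h2, ?_, ?_, ?_⟩
    · simp; omega
    · simp; omega
    · subst h3; simp; omega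
  · rintro ⟨r, hr, u, v, h1, h2, h3, h4, h5⟩
    have e1 : r.u2 ++ List.replicate (u.length - (r.u1.length + r.u2.length)) () ++ r.u1 = u :=
      aux_eq (by simp; omega)
    have e2 : r.u4 ++ List.replicate (v.length - (r.u3.length + r.u4.length)) () ++ r.u3 = v :=
      aux_eq (by simp; omega)
    refine ⟨r, hr, List.replicate (u.length - (r.u1.length + r.u2.length)) (),
      List.replicate (v.length - (r.u3.length + r.u4.length)) (), ?_, ?_, aux_conj.2 (aux_eq ?_)⟩
    · rw [e1]; exact h1
    · rw [e2]; exact h2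
    · simp; omega

theorem aux_closed (I : Set (List Unit)) (R : Set (CircRule Unit)) (w : List Unit)
    (h : CircStep R (CircLang I R) w) : w ∈ CircLang I R := by
  rw [aux_step] at h
  obtain ⟨r, hr, u, v, h1, h2, h3⟩ := h
  intro M hM
  exact hM.2 w ((aux_step _ _ _).2 ⟨r, hr, u, v, h1 M hM, h2 M hM, h3⟩)

theorem aux_empty (I : Set (List Unit)) : CircLang I (∅ : Set (CircRule Unit)) = I := by
  apply Set.Subset.antisymm
  · apply Set.sInter_subset_of_mem
    refine ⟨fun w hw w' h => aux_conj.1 h ▸ hw, ?_⟩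
    rintro w ⟨r, hr, _⟩
    exact hr.elim
  · intro w hw M hM
    exact hM.1 w hw w (aux_conj.2 rfl)

theorem stmt1 (L : Set (List Unit))
    (h : ∃ (I : Set (List Unit)) (R : Set (CircRule Unit)),
        I.Finite ∧ R.Finite ∧ L = CircLang I R) :
    ∃ I : Set (List Unit), I.Finite ∧
      (L = CircLang I (∅ : Set (CircRule Unit)) ∨
        ∃ r : CircRule Unit, L = CircLang I {r}) := by
  obtain ⟨I, R, hI, -, hL⟩ := h
  by_cases hfin : L.Finite
  · exact ⟨L, hfin, Or.inl (aux_empty L).symm⟩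
  have fin_lt : ∀ n : ℕ, {w : List Unit | w.length < n}.Finite := fun n =>
    List.finite_length_lt Unit n
  have unb : ∀ n : ℕ, ∃ w ∈ L, n ≤ w.length := by
    intro n
    by_contra hc
    push Not at hc
    exact hfin ((fin_lt n).subset hc)
  obtain ⟨r, hr⟩ : R.Nonempty := by
    rw [Set.nonempty_iff_ne_empty]
    rintro rfl
    rw [aux_empty] at hL
    exact hfin (hL ▸ hI)
  have step : ∀ u v w : List Unit, u ∈ L → v ∈ L → r.u1.length + r.u2.length ≤ u.length →
      r.u3.length + r.u4.length ≤ v.length → w.length = u.length + v.length → w ∈ L := by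
    intro u v w h1 h2 h3 h4 h5
    rw [hL] at h1 h2 ⊢
    exact aux_closed _ _ _ ((aux_step _ _ _).2 ⟨r, hr, u, v, h1, h2, h3, h4, h5⟩)
  set P := r.u1.length + r.u2.length with hP
  set Q := r.u3.length + r.u4.length with hQ
  let G : Set ℕ := {n | P ≤ n ∧ List.replicate n () ∈ L}
  have memG : ∀ w ∈ L, P ≤ w.length → w.length ∈ G := fun w hw hp =>
    ⟨hp, by rwa [aux_eq (w := List.replicate w.length ()) (w' := w) (by simp)]⟩
  obtain ⟨n1, hn1⟩ := Nat.exists_mem_closure_of_ge G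
  set d := Nat.setGcd G with hd
  have hdvd : ∀ w ∈ L, P ≤ w.length → d ∣ w.length := fun w hw hp =>
    Nat.setGcd_dvd_of_mem (memG w hw hp)
  obtain ⟨z, hz, hzl⟩ := unb (P + Q + 1)
  have hdz := hdvd z hz (by omega)
  have dpos : 0 < d := Nat.pos_of_dvd_of_pos hdz (by omega)
  have clos : ∀ m ∈ AddSubmonoid.closure G, ∀ v ∈ L, Q ≤ v.length → ∀ w : List Unit,
      w.length = m + v.length → w ∈ L := by
    intro m hm
    induction hm using AddSubmonoid.closure_induction with
    | mem x hx =>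
      intro v hv hq w hw
      exact step (List.replicate x ()) v w hx.2 hv (by simpa using hx.1) hq (by simpa using hw)
    | zero =>
      intro v hv hq w hw
      rwa [aux_eq (w := w) (w' := v) (by omega)]
    | add x y _ _ hx hy =>
      intro v hv hq w hw
      refine hx (List.replicate (y + v.length) ()) (hy v hv hq _ (by simp)) (by simp; omega) w ?_
      simp; omega
  -- threshold
  set N := d * (n1 + z.length) with hN
  have hNge : n1 + z.length ≤ N := Nat.le_mul_of_pos_left _ dpos
  have big : ∀ w : List Unit, N ≤ w.length → d ∣ w.length → w ∈ L := by
    intro w hw hdw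
    refine clos (w.length - z.length) (hn1 _ (by omega) (Nat.dvd_sub hdw hdz)) z hz (by omega) w
      (by omega)
  refine ⟨L ∩ {w | w.length < 2 * N}, (fin_lt _).subset Set.inter_subset_right, Or.inr
    ⟨⟨List.replicate N (), [], List.replicate N (), []⟩, ?_⟩⟩
  apply Set.Subset.antisymm
  · intro w hw M hM
    obtain ⟨hM1, hM2⟩ := hM
    induction hl : w.length using Nat.strong_induction_on generalizing w with
    | _ n ih =>
      by_cases hlt : w.length < 2 * N
      · exact hM1 w ⟨hw, hlt⟩ w (aux_conj.2 rfl)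
      · have hdw := hdvd w hw (by omega)
        have dN : d ∣ N := Dvd.intro _ rfl
        apply hM2
        rw [aux_step]
        refine ⟨_, rfl, List.replicate N (), List.replicate (w.length - N) (), ?_, ?_, ?_, ?_, ?_⟩
        · exact ih N (by omega) (big (List.replicate N ()) (by simp) (by simpa using dN)) (by simp)
        · exact ih (w.length - N) (by omega)
            (big (List.replicate (w.length - N) ()) (by simp; omega) (by simpa using Nat.dvd_sub hdw dN)) (by simp)
        · simp
        · simp; omega
        · simp; omega
  · apply Set.sInter_subset_of_mem
    refine ⟨fun w hw w' h => aux_conj.1 h ▸ hw.1, ?_⟩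
    intro w hw
    rw [aux_step] at hw
    obtain ⟨_, rfl, u, v, hu, hv, h3, h4, h5⟩ := hw
    simp at h3 h4
    apply big
    · omega
    · rw [h5]
      exact Nat.dvd_add (hdvd u hu (by omega)) (hdvd v hv (by omega))
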